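/- Let $x_1,\dots,x_d\in\mathbb{Z}^d$ be linearly independent over $\mathbb{R}$, let $S=\mathbb{R}_+x_1+\dots+\mathbb{R}_+x_d$, let $\Gamma(S)$ be the subgroup of $\mathbb{Z}^d$ generated by $x_1,\dots,x_d$, and let $\Sigma(S)$ be the additive submonoid generated by $x_1,\dots,x_d$. Then $\Gamma(S)=\mathbb{Z}^d$ if and only if $\Sigma(S)=S\cap\mathbb{Z}^d$. -/

import Mathlib

/-- The real vector corresponding to an integer vector. -/
def toR {d : ℕ} (x : Fin d → ℤ) : Fin d → ℝ := fun i => (x i : ℝ)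

/-- The cone generated by a finite family of integer vectors. -/
def coneFin {d n : ℕ} (v : Fin n → (Fin d → ℤ)) : Set (Fin d → ℝ) :=
  { y | ∃ a : Fin n → ℝ, (∀ i, 0 ≤ a i) ∧ y = ∑ i, a i • toR (v i) }

/-- The cone generated by a set of integer vectors (nonnegative real combinations
of finitely many of its elements). -/
def coneSet {d : ℕ} (B : Set (Fin d → ℤ)) : Set (Fin d → ℝ) :=
  { y | ∃ (n : ℕ) (v : Fin n → (Fin d → ℤ)) (a : Fin n → ℝ),
      (∀ i, v i ∈ B) ∧ (∀ i, 0 ≤ a i) ∧ y = ∑ i, a i • toR (v i) }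

/-- A finitely generated rational cone. -/
def IsRatCone {d : ℕ} (C : Set (Fin d → ℝ)) : Prop :=
  ∃ B : Finset (Fin d → ℤ), C = coneSet (B : Set (Fin d → ℤ))

/-- A pointed cone: `x, -x ∈ C` implies `x = 0`. -/
def PointedSet {d : ℕ} (C : Set (Fin d → ℝ)) : Prop :=
  ∀ x ∈ C, -x ∈ C → x = 0

/-- A full-dimensional subset of `ℝ^d`. -/
def FullDim {d : ℕ} (C : Set (Fin d → ℝ)) : Prop :=
  Submodule.span ℝ C = ⊤

/-- The Hilbert basis of the monoid `C ∩ ℤ^d`: the nonzero lattice points of `C`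
admitting no decomposition into two nonzero lattice points of `C`. -/
def hilbC {d : ℕ} (C : Set (Fin d → ℝ)) : Set (Fin d → ℤ) :=
  { z | toR z ∈ C ∧ z ≠ 0 ∧
    ¬∃ u v : Fin d → ℤ, toR u ∈ C ∧ toR v ∈ C ∧ u ≠ 0 ∧ v ≠ 0 ∧ z = u + v }

theorem toR_sum_zsmul {d n : ℕ} (x : Fin n → (Fin d → ℤ)) (c : Fin n → ℤ) :
    toR (∑ k, c k • x k) = ∑ k, (c k : ℝ) • toR (x k) := by
  ext i
  simp [toR, Finset.sum_apply]

theorem toR_sub {d : ℕ} (u v : Fin d → ℤ) : toR (u - v) = toR u - toR v := by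
  ext i
  simp [toR]

theorem toR_mem_coneFin_of_mem_closure {d n : ℕ} (x : Fin n → (Fin d → ℤ)) {v : Fin d → ℤ}
    (hv : v ∈ AddSubmonoid.closure (Set.range x)) : toR v ∈ coneFin x := by
  induction hv using AddSubmonoid.closure_induction with
  | mem y hy =>
    obtain ⟨k, rfl⟩ := hy
    refine ⟨Pi.single k 1, fun i => ?_, ?_⟩
    · by_cases h : i = k
      · subst h
        simp
      · simp [h]
    · simp [Pi.single_apply, ite_smul]
  | zero =>
    refine ⟨0, fun _ => le_rfl, ?_⟩
    ext i
    simp [toR]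
  | add y z _ _ hy hz =>
    obtain ⟨a, ha, hya⟩ := hy
    obtain ⟨b, hb, hzb⟩ := hz
    refine ⟨a + b, fun i => add_nonneg (ha i) (hb i), ?_⟩
    have h : toR (y + z) = toR y + toR z := by
      ext i
      simp [toR]
    simp only [h, hya, hzb, Pi.add_apply, add_smul, Finset.sum_add_distrib]

theorem mem_closure_range_iff_exists_sum_zsmul {d n : ℕ} (x : Fin n → (Fin d → ℤ))
    (v : Fin d → ℤ) :
    v ∈ AddSubgroup.closure (Set.range x) ↔ ∃ c : Fin n → ℤ, ∑ k, c k • x k = v := by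
  rw [← Submodule.mem_span_range_iff_exists_fun ℤ, ← Submodule.mem_toAddSubgroup,
    Submodule.span_int_eq_addSubgroupClosure]

/-- For linearly independent `x₁, …, x_d ∈ ℤ^d` generating the cone `S`:
`Γ(S) = ℤ^d` (the cone is unimodular) iff `Σ(S) = S ∩ ℤ^d`. -/
theorem gamma_top_iff_sigma_eq_lattice_points {d : ℕ} (x : Fin d → (Fin d → ℤ))
    (hind : LinearIndependent ℝ (fun k => toR (x k))) :
    AddSubgroup.closure (Set.range x) = ⊤ ↔
      ∀ v : Fin d → ℤ, v ∈ AddSubmonoid.closure (Set.range x) ↔ toR v ∈ coneFin x := by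
  constructor
  · intro htop v
    refine ⟨toR_mem_coneFin_of_mem_closure x, ?_⟩
    rintro ⟨a, ha, hva⟩
    obtain ⟨c, rfl⟩ := (mem_closure_range_iff_exists_sum_zsmul x v).1 (htop ▸ AddSubgroup.mem_top v)
    rw [toR_sum_zsmul] at hva
    have hca := Fintype.linearIndependent_iffₛ.1 hind _ _ hva
    refine AddSubmonoid.sum_mem _ fun k _ => ?_
    have hk : 0 ≤ c k := by
      have h := ha k
      rw [← hca k] at h
      exact_mod_cast h
    obtain ⟨m, hm⟩ := Int.eq_ofNat_of_zero_le hk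
    rw [hm, natCast_zsmul]
    exact AddSubmonoid.nsmul_mem _ (AddSubmonoid.subset_closure (Set.mem_range_self k)) m
  · intro h
    refine (AddSubgroup.eq_top_iff' _).2 fun v => ?_
    have hspan : Submodule.span ℝ (Set.range fun k => toR (x k)) = ⊤ :=
      hind.span_eq_top_of_card_eq_finrank' (by simp)
    obtain ⟨a, hav⟩ := (Submodule.mem_span_range_iff_exists_fun ℝ).1
      (hspan ▸ Submodule.mem_top : toR v ∈ Submodule.span ℝ (Set.range fun k => toR (x k)))
    have hfract : toR (v - ∑ k, ⌊a k⌋ • x k) ∈ coneFin x := by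
      refine ⟨fun k => Int.fract (a k), fun k => Int.fract_nonneg _, ?_⟩
      rw [toR_sub, toR_sum_zsmul, ← hav, ← Finset.sum_sub_distrib]
      simp only [← sub_smul, Int.self_sub_floor]
    have hle : AddSubmonoid.closure (Set.range x) ≤
        (AddSubgroup.closure (Set.range x)).toAddSubmonoid :=
      AddSubmonoid.closure_le.2 AddSubgroup.subset_closure
    have hfloor : ∑ k, ⌊a k⌋ • x k ∈ AddSubgroup.closure (Set.range x) :=
      (mem_closure_range_iff_exists_sum_zsmul x _).2 ⟨_, rfl⟩
    simpa using AddSubgroup.add_mem _ (hle ((h _).2 hfract)) hfloor
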